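/- For every integer k ≥ 1, if G is a finite connected graph that contains a cycle and has girth g, then γ_k(G) ≥ g/(2k + 1). -/

import Mathlib

/-- `S` is a distance `k`-dominating set of `G`: every vertex is joined to some
vertex of `S` by a path (walk) of length at most `k`. -/
def SimpleGraph.IsKDomSet {V : Type*} (G : SimpleGraph V) (k : ℕ) (S : Set V) : Prop :=
  ∀ v : V, ∃ u ∈ S, ∃ p : G.Walk u v, p.length ≤ k

/-- The distance `k`-domination number of `G`: the minimum cardinality of a
distance `k`-dominating set. -/
noncomputable def SimpleGraph.kDomNum {V : Type*} (G : SimpleGraph V) (k : ℕ) : ℕ :=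
  sInf {n : ℕ | ∃ S : Set V, G.IsKDomSet k S ∧ S.ncard = n}

theorem aux_path_le {V : Type*} {T : SimpleGraph V} (hT : T.IsAcyclic) {u v : V}
    (q : T.Walk u v) (hq : q.IsPath) (w : T.Walk u v) : q.length ≤ w.length := by
  classical
  have h := hT.path_unique ⟨q, hq⟩ w.toPath
  have h2 : q = w.bypass := congrArg Subtype.val h
  rw [h2]
  exact w.length_bypass_le

theorem aux_segment {V : Type*} {T : SimpleGraph V} (hT : T.IsAcyclic) {u v : V}
    (p : T.Walk u v) (hp : p.IsPath) (i j : ℕ) (hij : i ≤ j) (hj : j ≤ p.length)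
    (w : T.Walk (p.getVert i) (p.getVert j)) : j - i ≤ w.length := by
  have hq : ((p.drop i).take (j - i)).IsPath := (hp.drop i).take _
  have he : p.getVert j = (p.drop i).getVert (j - i) := by
    rw [SimpleGraph.Walk.drop_getVert]; congr 1; omega
  have := aux_path_le hT _ hq (w.copy rfl he)
  rw [SimpleGraph.Walk.length_copy, SimpleGraph.Walk.take_length,
    SimpleGraph.Walk.drop_length] at this
  omega

/-- A path in a forest with a `k`-dominating set `S` has at most `|S|(2k+1)` vertices. -/
theorem aux_path_bound {V : Type*} [Fintype V] {T : SimpleGraph V} (hT : T.IsAcyclic) (k : ℕ)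
    (S : Set V) (hS : T.IsKDomSet k S) {u v : V} (p : T.Walk u v) (hp : p.IsPath) :
    p.length + 1 ≤ S.ncard * (2 * k + 1) := by
  classical
  choose f hfS w hw using hS
  rw [Set.ncard_eq_toFinset_card' S]
  have := Finset.card_le_mul_card_image_of_maps_to
    (s := Finset.range (p.length + 1)) (t := S.toFinset) (f := fun i => f (p.getVert i))
    (by intro i _; simpa using hfS _) (2 * k + 1) ?_
  · rw [Finset.card_range] at this
    linarith
  · intro s _
    set A := {i ∈ Finset.range (p.length + 1) | f (p.getVert i) = s} with hA
    rcases A.eq_empty_or_nonempty with h | h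
    · simp [h]
    · have hm := A.min'_mem h
      set m := A.min' h with hmdef
      have hsub : A ⊆ Finset.Icc m (m + 2 * k) := by
        intro j hj
        have hmj : m ≤ j := A.min'_le j hj
        rw [Finset.mem_Icc]
        refine ⟨hmj, ?_⟩
        rw [hA, Finset.mem_filter, Finset.mem_range] at hm hj
        have hff : f (p.getVert m) = f (p.getVert j) := hm.2.trans hj.2.symm
        have := aux_segment hT p hp m j hmj (by omega)
          ((w (p.getVert m)).reverse.append ((w (p.getVert j)).copy hff.symm rfl))
        rw [SimpleGraph.Walk.length_append, SimpleGraph.Walk.length_reverse,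
          SimpleGraph.Walk.length_copy] at this
        have h1 := hw (p.getVert m)
        have h2 := hw (p.getVert j)
        omega
      refine (Finset.card_le_card hsub).trans ?_
      rw [Nat.card_Icc]
      omega

/-- There is an acyclic subgraph in which `S` is still `k`-dominating. -/
theorem aux_forest {V : Type*} [Fintype V] (G : SimpleGraph V) (k : ℕ)
    (S : Set V) (hS : G.IsKDomSet k S) :
    ∃ F : SimpleGraph V, F ≤ G ∧ F.IsAcyclic ∧ F.IsKDomSet k S := by
  classical
  have hex : ∀ v, ∃ n, ∃ u ∈ S, ∃ p : G.Walk v u, p.length = n := by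
    intro v
    obtain ⟨u, hu, p, _⟩ := hS v
    exact ⟨_, u, hu, p.reverse, rfl⟩
  obtain ⟨d, hd⟩ : ∃ d : V → ℕ, ∀ v, d v = Nat.find (hex v) := ⟨_, fun _ => rfl⟩
  have hd0 : ∀ v, d v = 0 → v ∈ S := by
    intro v hv
    obtain ⟨u, hu, p, hp⟩ := Nat.find_spec (hex v)
    rw [← hd, hv] at hp
    rw [SimpleGraph.Walk.eq_of_length_eq_zero hp]
    exact hu
  have hdk : ∀ v, d v ≤ k := by
    intro v
    obtain ⟨u, hu, p, hp⟩ := hS v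
    rw [hd]
    exact (Nat.find_min' (hex v) ⟨u, hu, p.reverse, rfl⟩).trans (by simpa using hp)
  have hpar : ∀ v, ∃ w, d v ≠ 0 → G.Adj v w ∧ d w < d v := by
    intro v
    obtain ⟨u, hu, p, hp⟩ := Nat.find_spec (hex v)
    rw [← hd] at hp
    cases p with
    | nil => exact ⟨v, fun h => absurd hp.symm h⟩
    | @cons _ w _ h q =>
      refine ⟨w, fun _ => ⟨h, ?_⟩⟩
      have : d w ≤ q.length := by
        rw [hd]
        exact Nat.find_min' (hex w) ⟨u, hu, q, rfl⟩
      rw [SimpleGraph.Walk.length_cons] at hp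
      omega
  choose par hpar using hpar
  let F : SimpleGraph V :=
    { Adj := fun a b => (d a ≠ 0 ∧ b = par a) ∨ (d b ≠ 0 ∧ a = par b)
      symm := ⟨fun a b h => h.symm⟩
      loopless := ⟨by
        intro a h
        have h' : d a ≠ 0 ∧ a = par a := by tauto
        have := (hpar a h'.1).2
        rw [← h'.2] at this
        exact lt_irrefl _ this⟩ }
  have hF : ∀ a b, F.Adj a b ↔ (d a ≠ 0 ∧ b = par a) ∨ (d b ≠ 0 ∧ a = par b) :=
    fun _ _ => Iff.rfl
  refine ⟨F, ?_, ?_, ?_⟩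
  · intro a b h
    rcases (hF a b).1 h with ⟨h0, rfl⟩ | ⟨h0, rfl⟩
    · exact (hpar a h0).1
    · exact (hpar b h0).1.symm
  · intro a c hc
    obtain ⟨x, hx, hmax⟩ := Finset.exists_max_image c.support.toFinset d
      ⟨a, by simp⟩
    rw [List.mem_toFinset] at hx
    have hc' := hc.rotate hx
    have key : ∀ y, y ∈ (c.rotate x hx).support → F.Adj x y → y = par x := by
      intro y hy hxy
      have hyx : d y ≤ d x := by
        apply hmax
        rw [List.mem_toFinset]
        exact (SimpleGraph.Walk.mem_support_rotate_iff c x hx).1 hy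
      rcases (hF x y).1 hxy with ⟨_, h⟩ | ⟨h0, h⟩
      · exact h
      · have := (hpar y h0).2
        rw [← h] at this
        omega
    have hnil := hc'.not_nil
    apply hc'.snd_ne_penultimate
    exact (key _ (SimpleGraph.Walk.getVert_mem_support _ _) (SimpleGraph.Walk.adj_snd hnil)).trans
      (key _ (SimpleGraph.Walk.getVert_mem_support _ _)
        (SimpleGraph.Walk.adj_penultimate hnil).symm).symm
  · have main : ∀ n v, d v ≤ n → ∃ u ∈ S, ∃ p : F.Walk u v, p.length ≤ n := by
      intro n
      induction n with
      | zero => exact fun v hv => ⟨v, hd0 v (by omega), .nil, by simp⟩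
      | succ n ih =>
        intro v hv
        by_cases h0 : d v = 0
        · exact ⟨v, hd0 v h0, .nil, by simp⟩
        · obtain ⟨u, hu, p, hp⟩ := ih (par v) (by have := (hpar v h0).2; omega)
          have hadj : F.Adj (par v) v := (hF _ _).2 (Or.inr ⟨h0, rfl⟩)
          exact ⟨u, hu, p.concat hadj, by simpa using hp⟩
    exact fun v => main k v (hdk v)

theorem aux_main {V : Type*} [Fintype V] (k : ℕ) (G : SimpleGraph V) (hG : G.Connected)
    (hcyc : ∃ (a : V) (c : G.Walk a a), c.IsCycle) (S : Set V) (hS : G.IsKDomSet k S) :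
    G.girth ≤ S.ncard * (2 * k + 1) := by
  obtain ⟨F, hFG, hFa, hFS⟩ := aux_forest G k S hS
  obtain ⟨T, hFT, hTG, hT⟩ := hG.exists_isTree_le_of_le_of_isAcyclic hFG hFa
  have hTS : T.IsKDomSet k S := by
    intro v
    obtain ⟨u, hu, p, hp⟩ := hFS v
    exact ⟨u, hu, p.mapLe hFT, by simpa using hp⟩
  have hne : ¬ G ≤ T := by
    intro h
    obtain ⟨a, c, hc⟩ := hcyc
    exact (hT.isAcyclic.anti h) c hc
  have hne' : ∃ u v, G.Adj u v ∧ ¬ T.Adj u v := by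
    by_contra! h
    exact hne fun u v => h u v
  obtain ⟨u, v, hG1, hT1⟩ := hne'
  obtain ⟨p, hp, -⟩ := hT.existsUnique_path v u
  have hb := aux_path_bound hT.isAcyclic k S hTS p hp
  have hcy : (SimpleGraph.Walk.cons hG1 (p.mapLe hTG)).IsCycle := by
    rw [SimpleGraph.Walk.cons_isCycle_iff]
    refine ⟨hp.mapLe hTG, fun h => hT1 ?_⟩
    rw [SimpleGraph.Walk.edges_mapLe_eq_edges] at h
    exact p.adj_of_mem_edges h
  have := SimpleGraph.girth_le_length hcy
  simp at this
  omega

/-- If `G` is a finite connected graph containing a cycle and with girth `g`,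
then `γ_k(G) ≥ g/(2k+1)`. -/
theorem kDomNum_ge_girth {V : Type*} [Fintype V] (k : ℕ) (hk : 1 ≤ k)
    (G : SimpleGraph V) (hG : G.Connected)
    (hcyc : ∃ (a : V) (c : G.Walk a a), c.IsCycle)
    (g : ℕ) (hg : G.girth = (g : ℕ∞)) :
    (g : ℝ) / (2 * k + 1) ≤ (G.kDomNum k : ℝ) := by
  have hne : {n : ℕ | ∃ S : Set V, G.IsKDomSet k S ∧ S.ncard = n}.Nonempty :=
    ⟨_, Set.univ, fun v => ⟨v, Set.mem_univ v, .nil, by simp⟩, rfl⟩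
  obtain ⟨S, hS, hn⟩ := Nat.sInf_mem hne
  have hn' : S.ncard = G.kDomNum k := hn
  have h := aux_main k G hG hcyc S hS
  have hg' : G.girth = g := by exact_mod_cast hg
  rw [hg', hn'] at h
  rw [div_le_iff₀ (by positivity)]
  exact_mod_cast h
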